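/- arXiv:2302.02215 — 3 statements merged into one kernel-verified Lean document; each statement's English description precedes it below -/
import Mathlib

section
/- Let G be a strongly connected digraph, let s be a vertex of G, and suppose the edge (u,r) is a bridge of the flow graph G_s. Let (x,y) be an edge of G such that r dominates y in G_s but r does not dominate x in G_s. Then x = u and y = r. -/
/-- A directed multigraph: a type `E` of potential edges with source and target
maps, together with the set of edges actually present in the digraph. -/
structure MultiDigraph (V : Type) (E : Type) where
  edges : Set E
  src : E → V
  tgt : E → V

namespace MultiDigraph

variable {V E : Type}

/-- `G.IsWalk u v l` : the list of edges `l` forms a walk from `u` to `v`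
(consecutive edges compose). -/
def IsWalk (G : MultiDigraph V E) : V → V → List E → Prop
  | u, v, [] => u = v
  | u, v, e :: l => e ∈ G.edges ∧ G.src e = u ∧ G.IsWalk (G.tgt e) v l

/-- A path from `u` to `v`: a walk using no edge more than once. -/
def IsTrail (G : MultiDigraph V E) (u v : V) (l : List E) : Prop :=
  G.IsWalk u v l ∧ l.Nodup

/-- `u` reaches `v`: there is a path from `u` to `v`. -/
def Reaches (G : MultiDigraph V E) (u v : V) : Prop :=
  ∃ l : List E, G.IsTrail u v l

/-- `u` and `v` are strongly connected: each reaches the other. -/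
def SConn (G : MultiDigraph V E) (u v : V) : Prop :=
  G.Reaches u v ∧ G.Reaches v u

/-- The digraph is strongly connected. -/
def StronglyConnected (G : MultiDigraph V E) : Prop :=
  ∀ u v : V, G.Reaches u v

/-- Delete the edge `e`. -/
def deleteEdge (G : MultiDigraph V E) (e : E) : MultiDigraph V E :=
  { G with edges := G.edges \ {e} }

/-- A strong bridge: an edge whose deletion destroys strong connectivity. -/
def IsStrongBridge (G : MultiDigraph V E) (e : E) : Prop :=
  e ∈ G.edges ∧ ¬ (G.deleteEdge e).StronglyConnected

end MultiDigraph

namespace MultiDigraph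

variable {V E : Type}

/-- `d` dominates `w` in the flow graph `G_s` : every path from `s` to `w`
contains the vertex `d`. -/
def Dominates (G : MultiDigraph V E) (s d w : V) : Prop :=
  ∀ l : List E, G.IsTrail s w l → (d = s ∨ ∃ e ∈ l, G.tgt e = d)

/-- `d` properly dominates `w` in `G_s`. -/
def ProperlyDominates (G : MultiDigraph V E) (s d w : V) : Prop :=
  G.Dominates s d w ∧ d ≠ w

/-- The edge `e` is a bridge of the flow graph `G_s` : every path from `s` to
the head of `e` contains the edge `e`. -/
def IsFlowBridge (G : MultiDigraph V E) (s : V) (e : E) : Prop :=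
  e ∈ G.edges ∧ ∀ l : List E, G.IsTrail s (G.tgt e) l → e ∈ l

end MultiDigraph

namespace MultiDigraph

theorem isWalk_append {V E : Type} (G : MultiDigraph V E) {u v : V} {l₁ l₂ : List E} :
    G.IsWalk u v (l₁ ++ l₂) ↔ ∃ w, G.IsWalk u w l₁ ∧ G.IsWalk w v l₂ := by
  induction l₁ generalizing u with
  | nil => simp [IsWalk]
  | cons e l ih => simp [IsWalk, ih, and_assoc]

end MultiDigraph

/-- Let `G` be strongly connected, and let the edge `e₀ = (u,r)`
be a bridge of the flow graph `G_s`. If `(x,y)` is an edge of `G` such that `r`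
dominates `y` but not `x` in `G_s`, then `x = u` and `y = r`. -/
theorem statement_4 {V E : Type} (G : MultiDigraph V E)
    (hG : G.StronglyConnected) (s : V)
    (e₀ : E) (u r : V) (hu : G.src e₀ = u) (hr : G.tgt e₀ = r)
    (hbr : G.IsFlowBridge s e₀)
    (e : E) (he : e ∈ G.edges) (x y : V) (hx : G.src e = x) (hy : G.tgt e = y)
    (hdy : G.Dominates s r y) (hdx : ¬ G.Dominates s r x) :
    x = u ∧ y = r := by
  subst hu hr hx hy
  unfold MultiDigraph.Dominates at hdx
  push Not at hdx
  obtain ⟨l, ⟨hw, hn⟩, hrs, hl⟩ := hdx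
  have hel : e ∉ l := by
    intro hel
    obtain ⟨l₁, l₂, rfl⟩ := List.append_of_mem hel
    rw [List.append_cons] at hw hn hl
    obtain ⟨w, hw₁, -⟩ := G.isWalk_append.1 hw
    have hwe : G.IsWalk s (G.tgt e) (l₁ ++ [e]) := by
      obtain ⟨a, ha, he', hsrc, -⟩ := G.isWalk_append.1 hw₁
      exact G.isWalk_append.2 ⟨a, ha, he', hsrc, rfl⟩
    obtain h | ⟨f, hf, hfr⟩ := hdy _ ⟨hwe, hn.of_append_left⟩
    · exact hrs h
    · exact hl f (List.mem_append_left _ hf) hfr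
  have htrail : G.IsTrail s (G.tgt e) (l ++ [e]) :=
    ⟨G.isWalk_append.2 ⟨_, hw, he, rfl, rfl⟩, by
      rw [← List.concat_eq_append]; exact hn.concat hel⟩
  have hy : G.tgt e = G.tgt e₀ := by
    obtain h | ⟨f, hf, hfr⟩ := hdy _ htrail
    · exact absurd h hrs
    · rcases List.mem_append.1 hf with hf | hf
      · exact absurd hfr (hl f hf)
      · rwa [List.mem_singleton.1 hf] at hfr
  have hmem := hbr.2 _ (hy ▸ htrail)
  rcases List.mem_append.1 hmem with hf | hf
  · exact absurd rfl (hl e₀ hf)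
  · rw [List.mem_singleton.1 hf]
    exact ⟨rfl, rfl⟩
end

section
/- The strongly orientable blocks of a mixed graph G form a partition of its vertex set: every vertex belongs to exactly one strongly orientable block. -/
/-- A mixed graph: a set of directed edges (with carrier `E`) and a set of
undirected edges (with carrier `F`, each with two endpoints). -/
structure MixedGraph (V E F : Type) where
  dEdges : Set E
  dsrc : E → V
  dtgt : E → V
  uEdges : Set F
  ufst : F → V
  usnd : F → V

namespace MixedGraph

variable {V E F : Type}

/-- The orientation of `G` determined by a choice `o` of a direction for each
undirected edge: all directed edges are kept, and each undirected edge is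
replaced by exactly one of its two possible directions. -/
def orient (G : MixedGraph V E F) (o : F → Bool) : MultiDigraph V (E ⊕ F) where
  edges := Sum.inl '' G.dEdges ∪ Sum.inr '' G.uEdges
  src := fun p =>
    match p with
    | Sum.inl e => G.dsrc e
    | Sum.inr f => if o f then G.ufst f else G.usnd f
  tgt := fun p =>
    match p with
    | Sum.inl e => G.dtgt e
    | Sum.inr f => if o f then G.usnd f else G.ufst f

/-- Delete a directed edge of the mixed graph. -/
def delD (G : MixedGraph V E F) (e : E) : MixedGraph V E F :=
  { G with dEdges := G.dEdges \ {e} }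

/-- Delete an undirected edge of the mixed graph. -/
def delU (G : MixedGraph V E F) (f : F) : MixedGraph V E F :=
  { G with uEdges := G.uEdges \ {f} }

end MixedGraph

namespace MixedGraph

variable {V E F : Type}

/-- There is an orientation of `G` in which all vertices of `C` are pairwise
strongly connected. -/
def StronglyOrientable (G : MixedGraph V E F) (C : Set V) : Prop :=
  ∃ o : F → Bool, ∀ a ∈ C, ∀ b ∈ C, (G.orient o).SConn a b

/-- A strongly orientable block: a maximal set of vertices `C` such that some
orientation of `G` makes all vertices of `C` pairwise strongly connected. -/
def IsSOBlock (G : MixedGraph V E F) (C : Set V) : Prop :=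
  G.StronglyOrientable C ∧
    ∀ C' : Set V, C ⊆ C' → G.StronglyOrientable C' → C' = C

end MixedGraph

open Relation

namespace MultiDigraph

variable {V E : Type}

theorem IsWalk.reflTransGen {D : MultiDigraph V E} {l : List E} {u v : V}
    (h : D.IsWalk u v l) :
    ReflTransGen (fun x y => ∃ e ∈ D.edges, D.src e = x ∧ D.tgt e = y) u v := by
  induction l generalizing u with
  | nil => rw [show u = v from h]
  | cons e l ih => exact .head ⟨e, h.1, h.2.1, rfl⟩ (ih h.2.2)

theorem IsWalk.of_append {D : MultiDigraph V E} {l₁ l₂ : List E} {e : E} {u v : V}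
    (h : D.IsWalk u v (l₁ ++ e :: l₂)) : D.IsWalk (D.src e) v (e :: l₂) := by
  induction l₁ generalizing u with
  | nil => exact ⟨h.1, rfl, h.2.2⟩
  | cons a l ih => exact ih h.2.2

theorem reaches_iff_reflTransGen {D : MultiDigraph V E} {u v : V} :
    D.Reaches u v ↔
      ReflTransGen (fun x y => ∃ e ∈ D.edges, D.src e = x ∧ D.tgt e = y) u v := by
  refine ⟨fun ⟨l, h⟩ => h.1.reflTransGen, fun h => ?_⟩
  induction h using ReflTransGen.head_induction_on with
  | refl => exact ⟨[], rfl, List.nodup_nil⟩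
  | head hstep _ ih =>
    obtain ⟨e, he, rfl, rfl⟩ := hstep
    obtain ⟨l, hl, hnd⟩ := ih
    by_cases hmem : e ∈ l
    · obtain ⟨l₁, l₂, rfl⟩ := List.append_of_mem hmem
      exact ⟨e :: l₂, hl.of_append, hnd.of_append_right⟩
    · exact ⟨e :: l, ⟨he, rfl, hl⟩, List.nodup_cons.2 ⟨hmem, hnd⟩⟩

theorem Reaches.trans {D : MultiDigraph V E} {u v w : V} (h₁ : D.Reaches u v)
    (h₂ : D.Reaches v w) : D.Reaches u w := by
  rw [reaches_iff_reflTransGen] at *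
  exact h₁.trans h₂

theorem SConn.refl (D : MultiDigraph V E) (u : V) : D.SConn u u :=
  ⟨⟨[], rfl, List.nodup_nil⟩, ⟨[], rfl, List.nodup_nil⟩⟩

theorem SConn.symm {D : MultiDigraph V E} {u v : V} (h : D.SConn u v) : D.SConn v u :=
  ⟨h.2, h.1⟩

theorem SConn.trans {D : MultiDigraph V E} {u v w : V} (h₁ : D.SConn u v)
    (h₂ : D.SConn v w) : D.SConn u w :=
  ⟨h₁.1.trans h₂.1, h₂.2.trans h₁.2⟩

end MultiDigraph

namespace MixedGraph

variable {V E F : Type}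

/-- The tail of the undirected edge `f` when oriented in direction `b`. -/
def tail (G : MixedGraph V E F) (f : F) (b : Bool) : V := if b then G.ufst f else G.usnd f

/-- The head of the undirected edge `f` when oriented in direction `b`. -/
def head (G : MixedGraph V E F) (f : F) (b : Bool) : V := if b then G.usnd f else G.ufst f

theorem tail_not (G : MixedGraph V E F) (f : F) (b : Bool) : G.tail f (!b) = G.head f b := by
  cases b <;> rfl

theorem head_not (G : MixedGraph V E F) (f : F) (b : Bool) : G.head f (!b) = G.tail f b := by
  cases b <;> rfl

/-- One step along a directed edge of `G`, or along an undirected edge of `G` in a direction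
allowed by `P`. -/
def Step (G : MixedGraph V E F) (P : Set (F × Bool)) (x y : V) : Prop :=
  (∃ e ∈ G.dEdges, G.dsrc e = x ∧ G.dtgt e = y) ∨
    ∃ f ∈ G.uEdges, ∃ b, (f, b) ∈ P ∧ G.tail f b = x ∧ G.head f b = y

/-- A partial orientation in which every oriented edge lies on a closed walk all of whose
undirected edges are oriented consistently. -/
structure IsCyclicPartial (G : MixedGraph V E F) (P : Set (F × Bool)) : Prop where
  not_mem_not : ∀ f b, (f, b) ∈ P → (f, !b) ∉ P
  mem_uEdges : ∀ f b, (f, b) ∈ P → f ∈ G.uEdges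
  closed : ∀ f b, (f, b) ∈ P → ReflTransGen (G.Step P) (G.head f b) (G.tail f b)

variable {G : MixedGraph V E F} {P Q : Set (F × Bool)}

theorem Step.mono (h : P ⊆ Q) {x y : V} (hs : G.Step P x y) : G.Step Q x y :=
  hs.imp_right fun ⟨f, hf, b, hb, hxy⟩ => ⟨f, hf, b, h hb, hxy⟩

theorem reflTransGen_step_mono (h : P ⊆ Q) {x y : V} (hs : ReflTransGen (G.Step P) x y) :
    ReflTransGen (G.Step Q) x y :=
  ReflTransGen.mono (fun _ _ => Step.mono h) _ _ hs

theorem orient_reaches_iff {o : F → Bool} {u v : V} :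
    (G.orient o).Reaches u v ↔ ReflTransGen (G.Step {p | p.2 = o p.1}) u v := by
  rw [MultiDigraph.reaches_iff_reflTransGen]
  have hstep : (fun x y => ∃ e ∈ (G.orient o).edges,
      (G.orient o).src e = x ∧ (G.orient o).tgt e = y) = G.Step {p | p.2 = o p.1} := by
    ext x y
    constructor
    · rintro ⟨_, ⟨e, he, rfl⟩ | ⟨f, hf, rfl⟩, hx, hy⟩
      · exact .inl ⟨e, he, hx, hy⟩
      · exact .inr ⟨f, hf, o f, rfl, hx, hy⟩
    · rintro (⟨e, he, hx, hy⟩ | ⟨f, hf, b, hb, hx, hy⟩)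
      · exact ⟨.inl e, .inl ⟨e, he, rfl⟩, hx, hy⟩
      · obtain rfl : b = o f := hb
        exact ⟨.inr f, .inr ⟨f, hf, rfl⟩, hx, hy⟩
  rw [hstep]

theorem exists_maximal_isCyclicPartial (G : MixedGraph V E F) :
    ∃ P, Maximal G.IsCyclicPartial P := by
  refine zorn_subset {P | G.IsCyclicPartial P} fun c hc hchain =>
    ⟨⋃₀ c, ⟨?_, ?_, ?_⟩, fun s hs => Set.subset_sUnion_of_mem hs⟩
  · rintro f b ⟨P, hP, hfP⟩ ⟨Q, hQ, hfQ⟩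
    rcases hchain.total hP hQ with h | h
    · exact (hc hQ).not_mem_not f b (h hfP) hfQ
    · exact (hc hP).not_mem_not f b hfP (h hfQ)
  · rintro f b ⟨P, hP, hfP⟩
    exact (hc hP).mem_uEdges f b hfP
  · rintro f b ⟨P, hP, hfP⟩
    exact reflTransGen_step_mono (Set.subset_sUnion_of_mem hP) ((hc hP).closed f b hfP)

/-- The directions of `Q` that lie on closed walks of `Q`. -/
def cyclicPart (G : MixedGraph V E F) (Q : Set (F × Bool)) : Set (F × Bool) :=
  {p | p ∈ Q ∧ p.1 ∈ G.uEdges ∧ ReflTransGen (G.Step Q) (G.head p.1 p.2) (G.tail p.1 p.2)}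

theorem reflTransGen_step_cyclicPart {x y : V} (hxy : ReflTransGen (G.Step Q) x y)
    (hyx : ReflTransGen (G.Step Q) y x) : ReflTransGen (G.Step (G.cyclicPart Q)) x y := by
  induction hxy using ReflTransGen.head_induction_on with
  | refl => exact .refl
  | head hstep hzy ih =>
    refine .head ?_ (ih (hyx.tail hstep))
    rcases hstep with h | ⟨f, hf, b, hb, rfl, rfl⟩
    · exact .inl h
    · exact .inr ⟨f, hf, b, ⟨hb, hf, hzy.trans hyx⟩, rfl, rfl⟩

theorem isCyclicPartial_cyclicPart (hQ : ∀ f b, (f, b) ∈ Q → (f, !b) ∉ Q) :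
    G.IsCyclicPartial (G.cyclicPart Q) where
  not_mem_not f b h h' := hQ f b h.1 h'.1
  mem_uEdges _ _ h := h.2.1
  closed f b h :=
    reflTransGen_step_cyclicPart h.2.2 (.single (.inr ⟨f, h.2.1, b, h.1, rfl, rfl⟩))

/-- The partial orientation `P`, completed by the orientation `o`. -/
def complete (P : Set (F × Bool)) (o : F → Bool) : Set (F × Bool) :=
  {p | p ∈ P ∨ (p.1, !p.2) ∉ P ∧ p.2 = o p.1}

theorem subset_complete (P : Set (F × Bool)) (o : F → Bool) : P ⊆ complete P o :=
  fun _ => .inl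

theorem IsCyclicPartial.complete_not_mem_not (hP : G.IsCyclicPartial P) (o : F → Bool) (f : F)
    (b : Bool) (h : (f, b) ∈ complete P o) : (f, !b) ∉ complete P o := by
  rintro (h' | ⟨h₁, h₂⟩)
  · rcases h with h | ⟨h, -⟩
    · exact hP.not_mem_not f b h h'
    · exact h h'
  · rcases h with h | ⟨-, h⟩
    · simp only [Bool.not_not] at h₁
      exact h₁ h
    · simp only at h h₂
      simp [← h] at h₂

theorem IsCyclicPartial.reflTransGen_complete (hP : G.IsCyclicPartial P) {o : F → Bool} {x y : V}
    (h : (G.orient o).Reaches x y) : ReflTransGen (G.Step (complete P o)) x y := by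
  rw [orient_reaches_iff] at h
  induction h with
  | refl => exact .refl
  | tail _ hstep ih =>
    refine ih.trans ?_
    rcases hstep with h | ⟨f, hf, b, hb, rfl, rfl⟩
    · exact .single (.inl h)
    · by_cases hrev : (f, !b) ∈ P
      · have := hP.closed f _ hrev
        rw [tail_not, head_not] at this
        exact reflTransGen_step_mono (subset_complete P o) this
      · exact .single (.inr ⟨f, hf, b, .inr ⟨hrev, hb⟩, rfl, rfl⟩)

theorem reflTransGen_step_of_maximal (hP : Maximal G.IsCyclicPartial P) {o : F → Bool} {x y : V}
    (h : (G.orient o).SConn x y) : ReflTransGen (G.Step P) x y := by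
  have hsub : P ⊆ G.cyclicPart (complete P o) := fun p hp =>
    ⟨.inl hp, hP.prop.mem_uEdges _ _ hp,
      reflTransGen_step_mono (subset_complete P o) (hP.prop.closed _ _ hp)⟩
  exact reflTransGen_step_mono
    (hP.le_of_ge (isCyclicPartial_cyclicPart (hP.prop.complete_not_mem_not o)) hsub)
    (reflTransGen_step_cyclicPart (hP.prop.reflTransGen_complete h.1)
      (hP.prop.reflTransGen_complete h.2))

/-- Some orientation strongly connects every pair of vertices that can be strongly connected by
any orientation. -/
theorem exists_orientation_forall_sConn (G : MixedGraph V E F) :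
    ∃ o₀ : F → Bool, ∀ o a b, (G.orient o).SConn a b → (G.orient o₀).SConn a b := by
  classical
  obtain ⟨P, hP⟩ := G.exists_maximal_isCyclicPartial
  have hsub : P ⊆ {p | p.2 = decide ((p.1, true) ∈ P)} := by
    rintro ⟨f, b⟩ h
    cases b
    · simpa using hP.prop.not_mem_not f false h
    · simpa using h
  refine ⟨fun f => decide ((f, true) ∈ P), fun o a b h => ⟨?_, ?_⟩⟩
  · exact orient_reaches_iff.2
      (reflTransGen_step_mono hsub (reflTransGen_step_of_maximal hP h))
  · exact orient_reaches_iff.2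
      (reflTransGen_step_mono hsub (reflTransGen_step_of_maximal hP h.symm))

end MixedGraph

/-- The strongly orientable blocks of a mixed graph `G`
partition its vertex set: every vertex belongs to exactly one strongly
orientable block. -/
theorem statement_8 {V E F : Type} (G : MixedGraph V E F) (v : V) :
    ∃! C : Set V, v ∈ C ∧ G.IsSOBlock C := by
  obtain ⟨o₀, ho₀⟩ := G.exists_orientation_forall_sConn
  have hv : v ∈ {w | (G.orient o₀).SConn v w} := .refl _ v
  have hC : G.StronglyOrientable {w | (G.orient o₀).SConn v w} :=
    ⟨o₀, fun _ ha _ hb => ha.symm.trans hb⟩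
  have hle : ∀ C, v ∈ C → G.StronglyOrientable C → C ⊆ {w | (G.orient o₀).SConn v w} :=
    fun C hvC ⟨o, ho⟩ w hw => ho₀ o v w (ho v hvC w hw)
  refine ⟨_, ⟨hv, hC, fun C' hsub hC' => (hle C' (hsub hv) hC').antisymm hsub⟩, ?_⟩
  rintro C ⟨hvC, hCo, hmax⟩
  exact (hmax _ (hle C hvC hCo) hC).symm
end

section
/- Let G be a strongly connected digraph and let (x,y) be a strong bridge of G. Then for any two vertices u and v of G: u and v are 2-edge twinless strongly connected in G if and only if u and v belong to the same strongly connected component C of G \ (x,y) and u and v are 2-edge twinless strongly connected in the digraph C' of S(G,(x,y)) corresponding to C. -/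
namespace MultiDigraph

variable {V E : Type}

/-- The list of edges `l` contains a pair of antiparallel (twin) edges
`(x,y)` and `(y,x)`. -/
def HasTwinPair (G : MultiDigraph V E) (l : List E) : Prop :=
  ∃ x y : V, x ≠ y ∧ (∃ e ∈ l, G.src e = x ∧ G.tgt e = y) ∧
    (∃ e ∈ l, G.src e = y ∧ G.tgt e = x)

/-- `u` and `v` are twinless strongly connected: there is a path from `u` to `v`
and a path from `v` to `u` whose union contains no pair of antiparallel edges. -/
def TwinlessConn (G : MultiDigraph V E) (u v : V) : Prop :=
  ∃ p q : List E, G.IsTrail u v p ∧ G.IsTrail v u q ∧ ¬ G.HasTwinPair (p ++ q)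

/-- `u` and `v` are 2-edge twinless strongly connected: they are twinless
strongly connected in `G \ e` for every edge `e` of `G`. -/
def TwoEdgeTwinlessConn (G : MultiDigraph V E) (u v : V) : Prop :=
  ∀ e ∈ G.edges, (G.deleteEdge e).TwinlessConn u v

end MultiDigraph

namespace MultiDigraph

variable {V E : Type}

/-- `C` is a strongly connected component of `G` (as a set of vertices):
the equivalence class of some vertex under mutual reachability. -/
def IsSCC (G : MultiDigraph V E) (C : Set V) : Prop :=
  ∃ c : V, C = {w | G.SConn c w}

/-- The digraph `C'` of `S(G,(x,y))` corresponding to the strongly connected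
component `C` of `G \ (x,y)`, where `(x,y)` is the strong bridge `e₀`:
it keeps every edge of `G` with both endpoints in `C`, adds one edge `(u,x)`
for every edge `(u,v)` of `G` with `u ∈ C`, `v ∉ C`, one edge `(y,v)` for every
edge `(u,v)` of `G` with `u ∉ C`, `v ∈ C`, and the extra edge `(x,y)`
(represented by `Sum.inr ()`). -/
noncomputable def sOp (G : MultiDigraph V E) (e₀ : E) (C : Set V) :
    MultiDigraph V (E ⊕ Unit) := by
  classical
  exact
    { edges := Sum.inl '' {e | e ∈ G.edges ∧ (G.src e ∈ C ∨ G.tgt e ∈ C)} ∪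
        {Sum.inr ()}
      src := fun p =>
        match p with
        | Sum.inl e => if G.src e ∈ C then G.src e else G.tgt e₀
        | Sum.inr _ => G.src e₀
      tgt := fun p =>
        match p with
        | Sum.inl e => if G.tgt e ∈ C then G.tgt e else G.src e₀
        | Sum.inr _ => G.tgt e₀ }

/-- The digraph `G` is strongly connected when regarded as a digraph with
vertex set `W` : every vertex of `W` reaches every other vertex of `W`. -/
def SCOn (G : MultiDigraph V E) (W : Set V) : Prop :=
  ∀ a ∈ W, ∀ b ∈ W, G.Reaches a b

end MultiDigraph

namespace MultiDigraph

variable {V E : Type}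

/-- One step along an edge of the set `S`. -/
def Step (G : MultiDigraph V E) (S : Set E) (a b : V) : Prop :=
  ∃ e ∈ S, G.src e = a ∧ G.tgt e = b

/-- Reachability along edges of the set `S`. -/
def ReachIn (G : MultiDigraph V E) (S : Set E) : V → V → Prop :=
  Relation.ReflTransGen (G.Step S)

/-- The edge set `S` contains no pair of antiparallel edges. -/
def TwinFree (G : MultiDigraph V E) (S : Set E) : Prop :=
  ∀ e ∈ S, ∀ f ∈ S, G.src f = G.tgt e → G.tgt f = G.src e → G.src e = G.tgt e

theorem reachIn_of_edge (G : MultiDigraph V E) {S : Set E} {e : E} (he : e ∈ S) :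
    G.ReachIn S (G.src e) (G.tgt e) :=
  .single ⟨e, he, rfl, rfl⟩

theorem ReachIn.mono {G : MultiDigraph V E} {S T : Set E} (h : S ⊆ T) {a b : V}
    (hab : G.ReachIn S a b) : G.ReachIn T a b :=
  Relation.ReflTransGen.mono (fun _ _ ⟨e, he, h'⟩ => ⟨e, h he, h'⟩) _ _ hab

theorem IsWalk.reachIn {G : MultiDigraph V E} {l : List E} {u v : V} (h : G.IsWalk u v l) :
    G.ReachIn {e | e ∈ l} u v := by
  induction l generalizing u with
  | nil => exact h ▸ .refl
  | cons e l ih =>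
    obtain ⟨-, rfl, h⟩ := h
    exact (G.reachIn_of_edge (by simp)).trans
      ((ih h).mono fun f hf => List.mem_cons_of_mem e hf)

theorem IsWalk.mem_edges {G : MultiDigraph V E} {l : List E} {u v : V} (h : G.IsWalk u v l) :
    ∀ e ∈ l, e ∈ G.edges := by
  induction l generalizing u with
  | nil => simp
  | cons e l ih =>
    obtain ⟨he, -, h⟩ := h
    simpa using ⟨he, ih h⟩

theorem IsWalk.of_append_s11 {G : MultiDigraph V E} {s l : List E} {u v : V}
    (h : G.IsWalk u v (s ++ l)) : ∃ w, G.IsWalk w v l := by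
  induction s generalizing u with
  | nil => exact ⟨u, h⟩
  | cons e s ih => exact ih h.2.2

theorem ReachIn.exists_isTrail {G : MultiDigraph V E} {S : Set E} (hS : S ⊆ G.edges) {u v : V}
    (h : G.ReachIn S u v) : ∃ l, G.IsTrail u v l ∧ ∀ e ∈ l, e ∈ S := by
  induction h using Relation.ReflTransGen.head_induction_on with
  | refl => exact ⟨[], ⟨rfl, List.nodup_nil⟩, by simp⟩
  | head hstep _ ih =>
    obtain ⟨e, he, rfl, rfl⟩ := hstep
    obtain ⟨l, ⟨hw, hn⟩, hl⟩ := ih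
    by_cases hel : e ∈ l
    · obtain ⟨s, t, rfl⟩ := List.append_of_mem hel
      obtain ⟨w, hw'⟩ := hw.of_append_s11
      refine ⟨e :: t, ⟨⟨hw'.1, rfl, hw'.2.2⟩, (List.nodup_append.1 hn).2.1⟩, fun f hf => ?_⟩
      exact hl f (List.mem_append_right s hf)
    · exact ⟨e :: l, ⟨⟨hS he, rfl, hw⟩, List.nodup_cons.2 ⟨hel, hn⟩⟩, by simpa using ⟨he, hl⟩⟩

theorem reaches_iff_reachIn (G : MultiDigraph V E) (u v : V) :
    G.Reaches u v ↔ G.ReachIn G.edges u v := by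
  constructor
  · rintro ⟨l, hl, -⟩
    exact hl.reachIn.mono hl.mem_edges
  · intro h
    obtain ⟨l, hl, -⟩ := h.exists_isTrail subset_rfl
    exact ⟨l, hl⟩

theorem reaches_deleteEdge_iff (G : MultiDigraph V E) (e : E) (u v : V) :
    (G.deleteEdge e).Reaches u v ↔ G.ReachIn (G.edges \ {e}) u v :=
  reaches_iff_reachIn _ _ _

theorem twinlessConn_iff (G : MultiDigraph V E) (u v : V) :
    G.TwinlessConn u v ↔
      ∃ S ⊆ G.edges, G.TwinFree S ∧ G.ReachIn S u v ∧ G.ReachIn S v u := by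
  constructor
  · rintro ⟨p, q, hp, hq, ht⟩
    refine ⟨{e | e ∈ p ++ q}, ?_, ?_, ?_, ?_⟩
    · intro e he
      rcases List.mem_append.1 he with he | he
      · exact hp.1.mem_edges e he
      · exact hq.1.mem_edges e he
    · intro e he f hf h₁ h₂
      by_contra hne
      exact ht ⟨_, _, hne, ⟨e, he, rfl, rfl⟩, ⟨f, hf, h₁, h₂⟩⟩
    · exact hp.1.reachIn.mono fun e he => List.mem_append_left q he
    · exact hq.1.reachIn.mono fun e he => List.mem_append_right p he
  · rintro ⟨S, hS, ht, huv, hvu⟩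
    obtain ⟨p, hp, hpS⟩ := huv.exists_isTrail hS
    obtain ⟨q, hq, hqS⟩ := hvu.exists_isTrail hS
    have hpq : ∀ e ∈ p ++ q, e ∈ S := fun e he =>
      (List.mem_append.1 he).elim (hpS e) (hqS e)
    refine ⟨p, q, hp, hq, ?_⟩
    rintro ⟨x, y, hxy, ⟨e, he, rfl, rfl⟩, ⟨f, hf, h₁, h₂⟩⟩
    exact hxy (ht e (hpq e he) f (hpq f hf) h₁ h₂)

theorem twinlessConn_deleteEdge_iff (G : MultiDigraph V E) (e : E) (u v : V) :
    (G.deleteEdge e).TwinlessConn u v ↔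
      ∃ S ⊆ G.edges \ {e}, G.TwinFree S ∧ G.ReachIn S u v ∧ G.ReachIn S v u :=
  twinlessConn_iff _ _ _

/-- The properties of a strongly connected component `C` of `G \ e₀`, for a strong bridge `e₀`
of a strongly connected digraph `G`. -/
structure IsBridgeComponent (G : MultiDigraph V E) (e₀ : E) (C : Set V) : Prop where
  mem_edges : e₀ ∈ G.edges
  reach_src : ∀ w, G.ReachIn (G.edges \ {e₀}) w (G.src e₀)
  tgt_reach : ∀ w, G.ReachIn (G.edges \ {e₀}) (G.tgt e₀) w
  not_reach : ¬ G.ReachIn (G.edges \ {e₀}) (G.src e₀) (G.tgt e₀)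
  reach : ∀ a ∈ C, ∀ b ∈ C, G.ReachIn (G.edges \ {e₀}) a b
  mem_of_reach : ∀ a ∈ C, ∀ b ∈ C, ∀ w, G.ReachIn (G.edges \ {e₀}) a w →
    G.ReachIn (G.edges \ {e₀}) w b → w ∈ C

theorem isBridgeComponent_of_isSCC {G : MultiDigraph V E} (hG : G.StronglyConnected) {e₀ : E}
    (hbr : G.IsStrongBridge e₀) {C : Set V} (hC : (G.deleteEdge e₀).IsSCC C) :
    G.IsBridgeComponent e₀ C := by
  have h₁ : ∀ w, G.ReachIn (G.edges \ {e₀}) w (G.src e₀) := by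
    intro w
    have h := (G.reaches_iff_reachIn _ _).1 (hG w (G.src e₀))
    induction h using Relation.ReflTransGen.head_induction_on with
    | refl => exact .refl
    | head hstep _ ih =>
      obtain ⟨e, he, rfl, rfl⟩ := hstep
      by_cases hee : e = e₀
      · subst hee; exact .refl
      · exact .head ⟨e, ⟨he, hee⟩, rfl, rfl⟩ ih
  have h₂ : ∀ w, G.ReachIn (G.edges \ {e₀}) (G.tgt e₀) w := by
    intro w
    have h := (G.reaches_iff_reachIn _ _).1 (hG (G.tgt e₀) w)
    induction h with
    | refl => exact .refl
    | tail _ hstep ih =>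
      obtain ⟨e, he, rfl, rfl⟩ := hstep
      by_cases hee : e = e₀
      · subst hee; exact .refl
      · exact .tail ih ⟨e, ⟨he, hee⟩, rfl, rfl⟩
  obtain ⟨c, rfl⟩ := hC
  refine ⟨hbr.1, h₁, h₂, fun h => hbr.2 fun a b => ?_, ?_, ?_⟩
  · exact (G.reaches_deleteEdge_iff _ _ _).2 (((h₁ a).trans h).trans (h₂ b))
  all_goals simp only [Set.mem_ofPred_eq, SConn, reaches_deleteEdge_iff]
  · exact fun a ha b hb => ha.2.trans hb.1
  · exact fun a ha b hb w haw hwb => ⟨ha.1.trans haw, hwb.trans hb.2⟩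

section sOp

variable (G : MultiDigraph V E) (e₀ : E) {C : Set V}

theorem sOp_src_of_mem {e : E} (h : G.src e ∈ C) : (G.sOp e₀ C).src (.inl e) = G.src e :=
  if_pos h

theorem sOp_src_of_notMem {e : E} (h : G.src e ∉ C) : (G.sOp e₀ C).src (.inl e) = G.tgt e₀ :=
  if_neg h

theorem sOp_tgt_of_mem {e : E} (h : G.tgt e ∈ C) : (G.sOp e₀ C).tgt (.inl e) = G.tgt e :=
  if_pos h

theorem sOp_tgt_of_notMem {e : E} (h : G.tgt e ∉ C) : (G.sOp e₀ C).tgt (.inl e) = G.src e₀ :=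
  if_neg h

@[simp] theorem inl_mem_sOp_edges {e : E} :
    .inl e ∈ (G.sOp e₀ C).edges ↔ e ∈ G.edges ∧ (G.src e ∈ C ∨ G.tgt e ∈ C) := by
  simp [sOp, and_or_left]

@[simp] theorem inr_mem_sOp_edges : .inr () ∈ (G.sOp e₀ C).edges := by
  simp [sOp]

end sOp

namespace IsBridgeComponent

variable {G : MultiDigraph V E} {e₀ : E} {C : Set V}

theorem src_ne_tgt (h : G.IsBridgeComponent e₀ C) : G.src e₀ ≠ G.tgt e₀ := fun he =>
  h.not_reach (he ▸ .refl)

theorem tgt_notMem (h : G.IsBridgeComponent e₀ C) (hx : G.src e₀ ∈ C) : G.tgt e₀ ∉ C := fun hy =>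
  h.not_reach (h.reach _ hx _ hy)

theorem reach_edge {e : E} (he : e ∈ G.edges) (hne : e ≠ e₀) :
    G.ReachIn (G.edges \ {e₀}) (G.src e) (G.tgt e) :=
  G.reachIn_of_edge ⟨he, hne⟩

/-- If the source of the bridge lies in `C`, no other edge leaves `C`. -/
theorem tgt_mem (h : G.IsBridgeComponent e₀ C) (hx : G.src e₀ ∈ C) {e : E} (he : e ∈ G.edges)
    (hne : e ≠ e₀) (hs : G.src e ∈ C) : G.tgt e ∈ C :=
  h.mem_of_reach _ hs _ hx _ (reach_edge he hne) (h.reach_src _)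

/-- If the target of the bridge lies in `C`, no other edge enters `C`. -/
theorem src_mem (h : G.IsBridgeComponent e₀ C) (hy : G.tgt e₀ ∈ C) {e : E} (he : e ∈ G.edges)
    (hne : e ≠ e₀) (ht : G.tgt e ∈ C) : G.src e ∈ C :=
  h.mem_of_reach _ hy _ ht _ (h.tgt_reach _) (reach_edge he hne)

/-- The edge set of `C'` induced by an edge set of `G`, without copies of edges that became
antiparallel to the bridge. -/
def inducedEdges (G : MultiDigraph V E) (e₀ : E) (C : Set V) (S : Set E) : Set (E ⊕ Unit) :=
  {p | (∃ e ∈ S, p = .inl e ∧ e ≠ e₀ ∧ (G.src e ∈ C ∨ G.tgt e ∈ C) ∧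
      ¬ ((G.sOp e₀ C).src (.inl e) = G.tgt e₀ ∧ (G.sOp e₀ C).tgt (.inl e) = G.src e₀)) ∨
    (p = .inr () ∧ e₀ ∈ S)}

theorem twinFree_inducedEdges (h : G.IsBridgeComponent e₀ C) {S : Set E} (hS : S ⊆ G.edges)
    (ht : G.TwinFree S) : (G.sOp e₀ C).TwinFree (inducedEdges G e₀ C S) := by
  have key : ∀ e ∈ S, e ≠ e₀ → (G.src e ∈ C ∨ G.tgt e ∈ C) → ∀ f ∈ S, f ≠ e₀ →
      (G.src f ∈ C ∨ G.tgt f ∈ C) →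
      (G.sOp e₀ C).src (.inl f) = (G.sOp e₀ C).tgt (.inl e) →
      (G.sOp e₀ C).tgt (.inl f) = (G.sOp e₀ C).src (.inl e) →
      (G.sOp e₀ C).src (.inl e) = (G.sOp e₀ C).tgt (.inl e) := by
    intro e he hne hC f hf hnf hCf h₁ h₂
    have hxy := h.src_ne_tgt
    have hte := h.tgt_mem (e := e)
    have hse := h.src_mem (e := e)
    have htf := h.tgt_mem (e := f)
    have hsf := h.src_mem (e := f)
    have he' := hS he
    have hf' := hS hf
    have htw := ht e he f hf
    by_cases a : G.src e ∈ C <;> by_cases b : G.tgt e ∈ C <;>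
    by_cases c : G.src f ∈ C <;> by_cases d : G.tgt f ∈ C <;>
    simp only [a, b, c, d, sOp_src_of_mem, sOp_src_of_notMem, sOp_tgt_of_mem, sOp_tgt_of_notMem,
      not_false_eq_true] at h₁ h₂ ⊢ <;> grind
  rintro p (⟨e, he, rfl, hne, hC, hn⟩ | ⟨rfl, hp⟩) q (⟨f, hf, rfl, hnf, hCf, hnf'⟩ | ⟨rfl, hq⟩) h₁ h₂
  · exact key e he hne hC f hf hnf hCf h₁ h₂
  · exact absurd ⟨h₂.symm, h₁.symm⟩ hn
  · exact absurd ⟨h₁, h₂⟩ hnf'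
  · exact h₁

theorem reachIn_inducedEdges (h : G.IsBridgeComponent e₀ C) {S : Set E} (hS : S ⊆ G.edges)
    {u v : V} (hu : u ∈ C) (hv : v ∈ C) (huv : G.ReachIn S u v) :
    (G.sOp e₀ C).ReachIn (inducedEdges G e₀ C S) u v := by
  set R := (G.sOp e₀ C).ReachIn (inducedEdges G e₀ C S) with hR
  have bridge : e₀ ∈ S → R u (G.src e₀) → R u (G.tgt e₀) := fun he hx =>
    hx.trans ((G.sOp e₀ C).reachIn_of_edge (e := .inr ()) (.inr ⟨rfl, he⟩))
  have step : ∀ e ∈ S, e ≠ e₀ → (G.src e ∈ C ∨ G.tgt e ∈ C) →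
      ¬ ((G.sOp e₀ C).src (.inl e) = G.tgt e₀ ∧ (G.sOp e₀ C).tgt (.inl e) = G.src e₀) →
      R u ((G.sOp e₀ C).src (.inl e)) → R u ((G.sOp e₀ C).tgt (.inl e)) :=
    fun e he hne hC hn hx => hx.trans
      ((G.sOp e₀ C).reachIn_of_edge (e := .inl e) (.inl ⟨e, he, rfl, hne, hC, hn⟩))
  suffices key : (v ∈ C → R u v) ∧ (v ∉ C → (R u (G.src e₀) ∨ (G.tgt e₀ ∈ C ∧ R u (G.tgt e₀))) ∧
      (G.ReachIn (G.edges \ {e₀}) u v ∨ R u (G.tgt e₀))) from key.1 hv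
  clear hv
  induction huv with
  | refl => exact ⟨fun _ => .refl, fun hn => absurd hu hn⟩
  | tail _ hstep ih =>
    obtain ⟨e, he, rfl, rfl⟩ := hstep
    have hxy := h.tgt_notMem
    by_cases hee : e = e₀
    · subst hee
      by_cases a : G.src e ∈ C
      · exact ⟨fun hy => absurd hy (hxy a), fun _ =>
          ⟨.inl (ih.1 a), .inr (bridge he (ih.1 a))⟩⟩
      · have := (ih.2 a).1
        refine ⟨fun _ => this.elim (bridge he) And.right, fun b => ?_⟩
        have hx := this.resolve_right fun hb => b hb.1
        exact ⟨.inl hx, .inr (bridge he hx)⟩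
    · have hst := reach_edge (hS he) hee
      have := step e he hee
      by_cases a : G.src e ∈ C <;> by_cases b : G.tgt e ∈ C <;>
        simp only [a, b, sOp_src_of_mem, sOp_src_of_notMem, sOp_tgt_of_mem, sOp_tgt_of_notMem,
          not_false_eq_true, true_or, or_true, forall_const, not_true_eq_false, IsEmpty.forall_iff,
          true_and, and_true] at this ih ⊢
      · exact this (by rintro ⟨h₁, h₂⟩; exact hxy (h₂ ▸ b) (h₁ ▸ a)) ih
      · refine ⟨?_, .inl ((h.reach _ hu _ a).trans hst)⟩
        by_cases hy : G.src e = G.tgt e₀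
        · exact .inr (hy ▸ ⟨a, ih⟩)
        · exact .inl (this hy ih)
      · have hy : G.tgt e₀ ∉ C := fun hy => a (h.src_mem hy (hS he) hee b)
        have hn : ¬ G.ReachIn (G.edges \ {e₀}) u (G.src e) := fun hr =>
          a (h.mem_of_reach _ hu _ b _ hr hst)
        by_cases hx : G.tgt e = G.src e₀
        · exact hx ▸ ih.1.resolve_right fun hb => hy hb.1
        · exact this hx (ih.2.resolve_left hn)
      · exact ⟨ih.1, ih.2.imp_left fun hr => hr.trans hst⟩

theorem sOp_of_twoEdgeTwinlessConn (h : G.IsBridgeComponent e₀ C) {u v : V} (hu : u ∈ C)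
    (hv : v ∈ C) (huv : G.TwoEdgeTwinlessConn u v) : (G.sOp e₀ C).TwoEdgeTwinlessConn u v := by
  have key : ∀ e ∈ G.edges, ∀ p, (p = .inl e ∨ (p = .inr () ∧ e = e₀)) →
      ((G.sOp e₀ C).deleteEdge p).TwinlessConn u v := by
    intro e he p hp
    obtain ⟨S, hS, ht, h₁, h₂⟩ := (G.twinlessConn_deleteEdge_iff e u v).1 (huv e he)
    have hS' : S ⊆ G.edges := fun f hf => (hS hf).1
    refine (twinlessConn_deleteEdge_iff _ _ _ _).2 ⟨inducedEdges G e₀ C S, ?_,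
      h.twinFree_inducedEdges hS' ht, h.reachIn_inducedEdges hS' hu hv h₁,
      h.reachIn_inducedEdges hS' hv hu h₂⟩
    have heS : e ∉ S := fun heS => (hS heS).2 rfl
    rintro q (⟨f, hf, rfl, hnf, hC, -⟩ | ⟨rfl, hq⟩)
    · refine ⟨(inl_mem_sOp_edges _ _).2 ⟨hS' hf, hC⟩, ?_⟩
      rintro rfl
      rcases hp with hp | hp
      · exact heS (Sum.inl.inj hp ▸ hf)
      · exact Sum.inl_ne_inr hp.1
    · refine ⟨inr_mem_sOp_edges _ _, ?_⟩
      rintro rfl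
      rcases hp with hp | hp
      · exact Sum.inr_ne_inl hp
      · exact heS (hp.2 ▸ hq)
  rintro (e | ⟨⟩) hp
  · exact key e ((inl_mem_sOp_edges _ _).1 hp).1 _ (.inl rfl)
  · exact key e₀ h.mem_edges _ (.inr ⟨rfl, rfl⟩)

end IsBridgeComponent

/-- If every vertex reaches `x`, some rank function can be decreased from every vertex
other than `x`. -/
theorem exists_rank {r : V → V → Prop} {x : V} (h : ∀ w, Relation.ReflTransGen r w x) :
    ∃ d : V → ℕ, ∀ w, w ≠ x → ∃ w', r w w' ∧ d w' < d w := by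
  classical
  let P : ℕ → V → Prop := fun n =>
    Nat.rec (motive := fun _ => V → Prop) (· = x) (fun _ Q w => ∃ w', r w w' ∧ Q w') n
  have hP : ∀ w, ∃ n, P n w := by
    intro w
    induction h w using Relation.ReflTransGen.head_induction_on with
    | refl => exact ⟨0, rfl⟩
    | head hr _ ih =>
      obtain ⟨n, hn⟩ := ih
      exact ⟨n + 1, _, hr, hn⟩
  refine ⟨fun w => Nat.find (hP w), fun w hw => ?_⟩
  have hs := Nat.find_spec (hP w)
  cases hn : Nat.find (hP w) with
  | zero => rw [hn] at hs; exact absurd hs hw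
  | succ n =>
    rw [hn] at hs
    obtain ⟨w', hr, hw'⟩ := hs
    exact ⟨w', hr, (Nat.lt_succ_of_le (Nat.find_min' (hP w') hw')).trans_eq hn.symm⟩

namespace IsBridgeComponent

variable {G : MultiDigraph V E} {e₀ : E} {C : Set V}

/-- Edges outside `C` joining every exit of `C` to the source of the bridge. -/
theorem exists_exit_edges (h : G.IsBridgeComponent e₀ C) {u : V} (hu : u ∈ C) :
    ∃ T ⊆ G.edges \ {e₀}, G.TwinFree T ∧
      (∀ e ∈ T, G.src e ∉ C ∧ G.tgt e ∉ C ∧ G.ReachIn (G.edges \ {e₀}) u (G.src e)) ∧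
      ∀ w, w ∉ C → G.ReachIn (G.edges \ {e₀}) u w → G.ReachIn T w (G.src e₀) := by
  obtain ⟨d, hd⟩ := exists_rank h.reach_src
  refine ⟨{e | e ∈ G.edges \ {e₀} ∧ (G.src e ∉ C ∧ G.tgt e ∉ C ∧
    G.ReachIn (G.edges \ {e₀}) u (G.src e)) ∧ d (G.tgt e) < d (G.src e)},
    fun e he => he.1, ?_, fun e he => he.2.1, ?_⟩
  · intro e he f hf h₁ h₂
    have h₃ := he.2.2
    have h₄ := hf.2.2
    rw [h₁, h₂] at h₄
    exact absurd h₃ h₄.not_gt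
  · intro w
    induction hn : d w using Nat.strong_induction_on generalizing w with
    | _ n ih =>
      subst hn
      intro hw hr
      by_cases hwx : w = G.src e₀
      · exact hwx ▸ .refl
      · obtain ⟨w', ⟨e, he, rfl, rfl⟩, hlt⟩ := hd w hwx
        have hst := G.reachIn_of_edge he
        have ht : G.tgt e ∉ C := fun ht => hw (h.mem_of_reach _ hu _ ht _ hr hst)
        exact .head ⟨e, ⟨he, ⟨hw, ht, hr⟩, hlt⟩, rfl, rfl⟩ (ih _ hlt _ rfl ht (hr.trans hst))

/-- Edges outside `C` joining the target of the bridge to every entrance of `C`. -/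
theorem exists_entrance_edges (h : G.IsBridgeComponent e₀ C) {u : V} (hu : u ∈ C) :
    ∃ T ⊆ G.edges \ {e₀}, G.TwinFree T ∧
      (∀ e ∈ T, G.src e ∉ C ∧ G.tgt e ∉ C ∧ G.ReachIn (G.edges \ {e₀}) (G.tgt e) u) ∧
      ∀ w, w ∉ C → G.ReachIn (G.edges \ {e₀}) w u → G.ReachIn T (G.tgt e₀) w := by
  obtain ⟨d, hd⟩ := exists_rank (r := Function.swap (G.Step (G.edges \ {e₀})))
    fun w => Relation.reflTransGen_swap.2 (h.tgt_reach w)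
  refine ⟨{e | e ∈ G.edges \ {e₀} ∧ (G.src e ∉ C ∧ G.tgt e ∉ C ∧
    G.ReachIn (G.edges \ {e₀}) (G.tgt e) u) ∧ d (G.src e) < d (G.tgt e)},
    fun e he => he.1, ?_, fun e he => he.2.1, ?_⟩
  · intro e he f hf h₁ h₂
    have h₃ := he.2.2
    have h₄ := hf.2.2
    rw [h₁, h₂] at h₄
    exact absurd h₃ h₄.not_gt
  · intro w
    induction hn : d w using Nat.strong_induction_on generalizing w with
    | _ n ih =>
      subst hn
      intro hw hr
      by_cases hwy : w = G.tgt e₀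
      · exact hwy ▸ .refl
      · obtain ⟨w', ⟨e, he, rfl, rfl⟩, hlt⟩ := hd w hwy
        have hst := G.reachIn_of_edge he
        have hs : G.src e ∉ C := fun hs => hw (h.mem_of_reach _ hs _ hu _ hst hr)
        exact .tail (ih _ hlt _ rfl hs (hst.trans hr)) ⟨e, ⟨he, ⟨hs, hw, hr⟩, hlt⟩, rfl, rfl⟩

/-- Twinless strong connectivity in `C'` without the copy of `e` lifts to `G \ e`, for an edge
`e` other than the bridge that touches `C`. -/
theorem twinlessConn_of_sOp_inl (h : G.IsBridgeComponent e₀ C) {u v : V} (hu : u ∈ C) {e : E}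
    (hne : e ≠ e₀) (heC : G.src e ∈ C ∨ G.tgt e ∈ C)
    (huv : ((G.sOp e₀ C).deleteEdge (.inl e)).TwinlessConn u v) :
    (G.deleteEdge e).TwinlessConn u v := by
  obtain ⟨S', hS', ht, h₁, h₂⟩ := (twinlessConn_deleteEdge_iff _ _ _ _).1 huv
  obtain ⟨T, hT, hTt, hTC, hTr⟩ := h.exists_exit_edges hu
  obtain ⟨T', hT', hTt', hTC', hTr'⟩ := h.exists_entrance_edges hu
  let S₁ : Set E := {f | f ≠ e₀ ∧ .inl f ∈ S'}
  let S₂ : Set E := {f | f = e₀ ∧ .inr () ∈ S'}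
  let S : Set E := (S₁ ∪ S₂) ∪ (T ∪ T')
  have hS₁ : ∀ f ∈ S₁, f ∈ G.edges ∧ (G.src f ∈ C ∨ G.tgt f ∈ C) := fun f hf =>
    (inl_mem_sOp_edges _ _).1 (hS' hf.2).1
  have hsub : S ⊆ G.edges \ {e} := by
    rintro f ((hf | hf) | (hf | hf))
    · exact ⟨(hS₁ f hf).1, by rintro rfl; exact (hS' hf.2).2 rfl⟩
    · exact ⟨hf.1 ▸ h.mem_edges, by rintro rfl; exact hne hf.1⟩
    · exact ⟨(hT hf).1, by rintro rfl; exact heC.elim (hTC _ hf).1 (hTC _ hf).2.1⟩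
    · exact ⟨(hT' hf).1, by rintro rfl; exact heC.elim (hTC' _ hf).1 (hTC' _ hf).2.1⟩
  have sim : ∀ a b, (G.sOp e₀ C).ReachIn S' a b → G.ReachIn S a b := by
    intro a b hab
    induction hab with
    | refl => exact .refl
    | tail _ hstep ih =>
      refine ih.trans ?_
      obtain ⟨f | ⟨⟩, hf, rfl, rfl⟩ := hstep
      · obtain ⟨hfe, hfC⟩ := (inl_mem_sOp_edges _ _).1 (hS' hf).1
        by_cases hfe₀ : f = e₀
        · subst hfe₀
          by_cases a : G.src f ∈ C
          · rw [sOp_src_of_mem _ _ a, sOp_tgt_of_notMem _ _ (h.tgt_notMem a)]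
          · rw [sOp_src_of_notMem _ _ a, sOp_tgt_of_mem _ _ (hfC.resolve_left a)]
        · have hfS : G.ReachIn S (G.src f) (G.tgt f) :=
            G.reachIn_of_edge (.inl (.inl ⟨hfe₀, hf⟩))
          have hst := reach_edge hfe hfe₀
          by_cases a : G.src f ∈ C
          · rw [sOp_src_of_mem _ _ a]
            by_cases b : G.tgt f ∈ C
            · rwa [sOp_tgt_of_mem _ _ b]
            · rw [sOp_tgt_of_notMem _ _ b]
              exact hfS.trans ((hTr _ b ((h.reach _ hu _ a).trans hst)).mono
                fun _ hg => .inr (.inl hg))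
          · have b := hfC.resolve_left a
            rw [sOp_src_of_notMem _ _ a, sOp_tgt_of_mem _ _ b]
            exact ReachIn.mono (fun _ hg => .inr (.inr hg))
              (hTr' _ a (hst.trans (h.reach _ b _ hu))) |>.trans hfS
      · exact G.reachIn_of_edge (.inl (.inr ⟨rfl, hf⟩))
  have disj : ∀ w, w ∉ C → G.ReachIn (G.edges \ {e₀}) u w → ¬ G.ReachIn (G.edges \ {e₀}) w u :=
    fun w hw h₁ h₂ => hw (h.mem_of_reach _ hu _ hu _ h₁ h₂)
  -- A twin of a non-bridge edge touching `C` is the bridge or joins vertices of `C`.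
  have inner : ∀ f ∈ S₁, ∀ g ∈ S, G.src g = G.tgt f → G.tgt g = G.src f →
      G.src f = G.tgt f := by
    intro f hf g hg e₁ e₂
    obtain ⟨hfe, hfC⟩ := hS₁ f hf
    by_cases hge : g = e₀
    · have hgr : .inr () ∈ S' := by
        rcases hg with (hg | hg) | (hg | hg)
        · exact absurd hge hg.1
        · exact hg.2
        · exact absurd hge (hT hg).2
        · exact absurd hge (hT' hg).2
      subst hge
      have := ht _ hf.2 _ hgr
      by_cases a : G.src f ∈ C
      · have b : G.tgt f ∉ C := fun b => h.tgt_notMem (e₁ ▸ b) (e₂ ▸ a)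
        rw [sOp_src_of_mem _ _ a, sOp_tgt_of_notMem _ _ b] at this
        exact (this rfl e₂).trans e₁
      · have b := hfC.resolve_left a
        rw [sOp_src_of_notMem _ _ a, sOp_tgt_of_mem _ _ b] at this
        exact e₂.symm.trans (this e₁ rfl)
    · have hgE := (hsub hg).1
      have r₁ := reach_edge hfe hf.1
      have r₂ := reach_edge hgE hge
      rw [e₁, e₂] at r₂
      have hC₂ : G.src f ∈ C ∧ G.tgt f ∈ C := hfC.elim
        (fun a => ⟨a, h.mem_of_reach _ a _ a _ r₁ r₂⟩)
        (fun b => ⟨h.mem_of_reach _ b _ b _ r₂ r₁, b⟩)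
      rcases hg with (hg | hg) | (hg | hg)
      · have := ht _ hf.2 _ hg.2
        rw [sOp_src_of_mem _ _ hC₂.1, sOp_tgt_of_mem _ _ hC₂.2,
          sOp_src_of_mem _ _ (e₁ ▸ hC₂.2), sOp_tgt_of_mem _ _ (e₂ ▸ hC₂.1)] at this
        exact this e₁ e₂
      · exact absurd hg.1 hge
      · exact absurd (e₁ ▸ hC₂.2) (hTC _ hg).1
      · exact absurd (e₁ ▸ hC₂.2) (hTC' _ hg).1
  have exit_tgt : ∀ f ∈ T, G.ReachIn (G.edges \ {e₀}) u (G.tgt f) := fun f hf =>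
    (hTC f hf).2.2.trans (G.reachIn_of_edge (hT hf))
  have entrance_src : ∀ f ∈ T', G.ReachIn (G.edges \ {e₀}) (G.src f) u := fun f hf =>
    (G.reachIn_of_edge (hT' hf)).trans (hTC' f hf).2.2
  have exit_bridge : ∀ f ∈ T, G.src f ≠ G.tgt e₀ := fun f hf he =>
    disj _ (hTC f hf).1 (hTC f hf).2.2 (he ▸ h.tgt_reach u)
  have entrance_bridge : ∀ f ∈ T', G.tgt f ≠ G.src e₀ := fun f hf he =>
    disj _ (hTC' f hf).2.1 (he ▸ h.reach_src u) (hTC' f hf).2.2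
  have exit_entrance : ∀ f ∈ T, ∀ g ∈ T', G.src f ≠ G.tgt g := fun f hf g hg he =>
    disj _ (hTC f hf).1 (hTC f hf).2.2 (he ▸ (hTC' g hg).2.2)
  have exit_entrance' : ∀ f ∈ T, ∀ g ∈ T', G.tgt f ≠ G.src g := fun f hf g hg he =>
    disj _ (hTC f hf).2.1 (exit_tgt f hf) (he ▸ entrance_src g hg)
  refine (twinlessConn_deleteEdge_iff _ _ _ _).2 ⟨S, hsub, ?_, sim _ _ h₁, sim _ _ h₂⟩
  intro f hf g hg e₁ e₂
  by_cases hf₁ : f ∈ S₁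
  · exact inner f hf₁ g hg e₁ e₂
  by_cases hg₁ : g ∈ S₁
  · have := inner g hg₁ f hf e₂.symm e₁.symm
    rw [e₁, e₂] at this
    exact this.symm
  rcases hf with (hf | hf) | (hf | hf) <;> rcases hg with (hg | hg) | (hg | hg) <;>
    first
    | exact absurd hf hf₁
    | exact absurd hg hg₁
    | skip
  · obtain ⟨rfl, -⟩ := hf
    obtain ⟨rfl, -⟩ := hg
    exact e₁
  · exact absurd (hf.1 ▸ e₁) (exit_bridge g hg)
  · exact absurd (hf.1 ▸ e₂) (entrance_bridge g hg)
  · exact absurd (hg.1 ▸ e₂.symm) (exit_bridge f hf)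
  · exact hTt f hf g hg e₁ e₂
  · exact absurd e₂.symm (exit_entrance f hf g hg)
  · exact absurd (hg.1 ▸ e₁.symm) (entrance_bridge f hf)
  · exact absurd e₁ (exit_entrance g hg f hf)
  · exact hTt' f hf g hg e₁ e₂

/-- Twinless strong connectivity in `C'` without the copy of the bridge lifts to `G \ e`, for
an edge `e` that does not lie inside `C`. -/
theorem twinlessConn_of_sOp_inr (h : G.IsBridgeComponent e₀ C) {u v : V} (hu : u ∈ C)
    (hv : v ∈ C) {e : E} (he : ¬ (G.src e ∈ C ∧ G.tgt e ∈ C))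
    (huv : ((G.sOp e₀ C).deleteEdge (.inr ())).TwinlessConn u v) :
    (G.deleteEdge e).TwinlessConn u v := by
  obtain ⟨S', hS', ht, h₁, h₂⟩ := (twinlessConn_deleteEdge_iff _ _ _ _).1 huv
  let S : Set E := {f | .inl f ∈ S' ∧ G.src f ∈ C ∧ G.tgt f ∈ C}
  have sim : ∀ a ∈ C, ∀ b, (G.sOp e₀ C).ReachIn S' a b →
      (b ∈ C ∧ G.ReachIn S a b) ∨ (b = G.src e₀ ∧ G.src e₀ ∉ C) := by
    intro a ha b hab
    induction hab with
    | refl => exact .inl ⟨ha, .refl⟩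
    | tail _ hstep ih =>
      obtain ⟨f | ⟨⟩, hf, rfl, rfl⟩ := hstep
      swap
      · exact absurd rfl (hS' hf).2
      obtain ⟨hfe, hfC⟩ := (inl_mem_sOp_edges _ _).1 (hS' hf).1
      by_cases hs : G.src f ∈ C
      · rw [sOp_src_of_mem _ _ hs] at ih
        have ih := ih.resolve_right fun hb => hb.2 (hb.1 ▸ hs)
        by_cases hb : G.tgt f ∈ C
        · rw [sOp_tgt_of_mem _ _ hb]
          exact .inl ⟨hb, ih.2.trans (G.reachIn_of_edge ⟨hf, hs, hb⟩)⟩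
        · rw [sOp_tgt_of_notMem _ _ hb]
          by_cases hff : f = e₀
          · exact .inl (hff ▸ ih)
          · exact .inr ⟨rfl, fun hx => hb (h.tgt_mem hx hfe hff hs)⟩
      · have hb := hfC.resolve_left hs
        rw [sOp_src_of_notMem _ _ hs] at ih
        rw [sOp_tgt_of_mem _ _ hb]
        have ih := ih.resolve_right fun hb => h.src_ne_tgt hb.1.symm
        by_cases hff : f = e₀
        · exact .inl (hff ▸ ih)
        · exact absurd (h.src_mem ih.1 hfe hff hb) hs
  refine (twinlessConn_deleteEdge_iff _ _ _ _).2 ⟨S, ?_, ?_, ?_, ?_⟩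
  · exact fun f hf => ⟨((inl_mem_sOp_edges _ _).1 (hS' hf.1).1).1, by
      rintro rfl; exact he hf.2⟩
  · intro f hf g hg e₁ e₂
    have := ht _ hf.1 _ hg.1
    rw [sOp_src_of_mem _ _ hf.2.1, sOp_tgt_of_mem _ _ hf.2.2,
      sOp_src_of_mem _ _ hg.2.1, sOp_tgt_of_mem _ _ hg.2.2] at this
    exact this e₁ e₂
  · exact ((sim u hu v h₁).resolve_right fun hb => hb.2 (hb.1 ▸ hv)).2
  · exact ((sim v hv u h₂).resolve_right fun hb => hb.2 (hb.1 ▸ hu)).2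

theorem twoEdgeTwinlessConn_of_sOp (h : G.IsBridgeComponent e₀ C) {u v : V} (hu : u ∈ C)
    (hv : v ∈ C) (huv : (G.sOp e₀ C).TwoEdgeTwinlessConn u v) : G.TwoEdgeTwinlessConn u v := by
  intro e he
  by_cases hC : e ≠ e₀ ∧ (G.src e ∈ C ∨ G.tgt e ∈ C)
  · exact h.twinlessConn_of_sOp_inl hu hC.1 hC.2
      (huv _ ((inl_mem_sOp_edges _ _).2 ⟨he, hC.2⟩))
  · refine h.twinlessConn_of_sOp_inr hu hv ?_ (huv _ (inr_mem_sOp_edges _ _))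
    rintro ⟨hs, ht⟩
    have hee : e = e₀ := by
      by_contra hne
      exact hC ⟨hne, .inl hs⟩
    subst hee
    exact h.tgt_notMem hs ht

end IsBridgeComponent

end MultiDigraph

/-- Let `(x,y)` (the edge `e₀`) be a strong bridge of the
strongly connected digraph `G`. Two vertices `u`, `v` are 2-edge twinless
strongly connected in `G` iff they belong to the same strongly connected
component `C` of `G \ (x,y)` and are 2-edge twinless strongly connected in the
digraph `C'` of `S(G,(x,y))` corresponding to `C`. -/
theorem statement_11 {V E : Type} (G : MultiDigraph V E)
    (hG : G.StronglyConnected) (e₀ : E) (hbr : G.IsStrongBridge e₀) (u v : V) :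
    G.TwoEdgeTwinlessConn u v ↔
      ∃ C : Set V, (G.deleteEdge e₀).IsSCC C ∧ u ∈ C ∧ v ∈ C ∧
        (G.sOp e₀ C).TwoEdgeTwinlessConn u v := by
  constructor
  · intro h
    obtain ⟨S, hS, -, h₁, h₂⟩ := (G.twinlessConn_deleteEdge_iff _ _ _).1 (h e₀ hbr.1)
    have hC : (G.deleteEdge e₀).IsSCC {w | (G.deleteEdge e₀).SConn u w} := ⟨u, rfl⟩
    have hu : (G.deleteEdge e₀).SConn u u :=
      ⟨(G.reaches_deleteEdge_iff _ _ _).2 .refl, (G.reaches_deleteEdge_iff _ _ _).2 .refl⟩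
    have hv : (G.deleteEdge e₀).SConn u v :=
      ⟨(G.reaches_deleteEdge_iff _ _ _).2 (h₁.mono hS),
        (G.reaches_deleteEdge_iff _ _ _).2 (h₂.mono hS)⟩
    exact ⟨_, hC, hu, hv,
      (MultiDigraph.isBridgeComponent_of_isSCC hG hbr hC).sOp_of_twoEdgeTwinlessConn hu hv h⟩
  · rintro ⟨C, hC, hu, hv, h⟩
    exact (MultiDigraph.isBridgeComponent_of_isSCC hG hbr hC).twoEdgeTwinlessConn_of_sOp hu hv h
end
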